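/- Lemma 4 (single-cardinality multi-path bound). Let G = (V, E) be a DAG task with weight function c, let m ≥ 1 be an integer number of cores, and let (P_i)_{i=0}^{k} be a generalized path list with 0 ≤ k ≤ m − 1. Then for every execution sequence of G on m cores, the response time satisfies R ≤ len(G) + (vol(G) − Σ_{i=0}^{k} len(P_i)) / (m − k). -/

import Mathlib

/-! STATEMENT 1: Lemma 4 (single-cardinality multi-path bound). -/

noncomputable section

variable {V : Type*}

/-- `P` is a generalized path: its elements are pairwise comparable
under the ancestor relation (the transitive closure of the edge relation `E`). -/
def IsGenPath (E : V → V → Prop) (P : Finset V) : Prop :=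
  ∀ u ∈ P, ∀ v ∈ P, u ≠ v → Relation.TransGen E u v ∨ Relation.TransGen E v u

/-- The length of a (generalized) path: total weight of its vertices. -/
def pathLen (c : V → ℝ) (P : Finset V) : ℝ := ∑ v ∈ P, c v

/-- The volume of the DAG: total weight of all vertices. -/
def dagVol [Fintype V] (c : V → ℝ) : ℝ := ∑ v : V, c v

/-- `len(G)`: the maximum length of a generalized path of the DAG. -/
def dagLen [Fintype V] (E : V → V → Prop) (c : V → ℝ) : ℝ :=
  sSup { x : ℝ | ∃ P : Finset V, IsGenPath E P ∧ x = pathLen c P }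

/-- `v` is executing at time `t`. -/
def Executing (s e : V → ℝ) (t : ℝ) (v : V) : Prop := s v ≤ t ∧ t < s v + e v

lemma wellFounded_transGen [Finite V] {E : V → V → Prop}
    (hacyc : ∀ v : V, ¬ Relation.TransGen E v v) : WellFounded (Relation.TransGen E) :=
  haveI : Std.Irrefl (Relation.TransGen E) := ⟨hacyc⟩
  Finite.wellFounded_of_trans_of_irrefl _

lemma finish_le_start_of_transGen {E : V → V → Prop} {s e : V → ℝ} (he0 : ∀ v, 0 ≤ e v)
    (hprec : ∀ u v, E u v → s u + e u ≤ s v) {u v : V} (h : Relation.TransGen E u v) :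
    s u + e u ≤ s v := by
  induction h with
  | single h => exact hprec _ _ h
  | @tail b c _ hbc ih => linarith [hprec _ _ hbc, he0 b]

/-- A generalized path has at most one vertex executing at a time. -/
lemma IsGenPath.eq_of_executing {E : V → V → Prop} {s e : V → ℝ} (he0 : ∀ v, 0 ≤ e v)
    (hprec : ∀ u v, E u v → s u + e u ≤ s v) {P : Finset V} (hP : IsGenPath E P) {t : ℝ} {u v : V}
    (hu : u ∈ P) (hv : v ∈ P) (hut : Executing s e t u) (hvt : Executing s e t v) : u = v := by
  by_contra hne
  obtain ⟨hu1, hu2⟩ := hut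
  obtain ⟨hv1, hv2⟩ := hvt
  rcases hP u hu v hv hne with h | h <;>
    linarith [finish_le_start_of_transGen he0 hprec h]

/-- If not all cores are busy at time `t`, every vertex that has not started yet is a descendant
of a vertex executing at `t`. -/
lemma exists_executing_ancestor [Finite V] {E : V → V → Prop}
    (hacyc : ∀ v : V, ¬ Relation.TransGen E v v) {s e : V → ℝ} {m : ℕ} {t : ℝ}
    (hwc : (∃ v : V, t < s v ∧ ∀ u, E u v → s u + e u ≤ t) →
      Set.ncard {v : V | s v ≤ t ∧ t < s v + e v} = m)
    (hidle : Set.ncard {v : V | s v ≤ t ∧ t < s v + e v} ≠ m) (v : V) (hv : t < s v) :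
    ∃ u, Executing s e t u ∧ Relation.TransGen E u v := by
  induction v using (wellFounded_transGen hacyc).induction with
  | _ v ih =>
    obtain ⟨u, huv, hut⟩ : ∃ u, E u v ∧ t < s u + e u := by
      by_contra! h
      exact hidle (hwc ⟨v, hv, h⟩)
    rcases le_or_gt (s u) t with h | h
    · exact ⟨u, ⟨h, hut⟩, .single huv⟩
    · obtain ⟨w, hw, hwu⟩ := ih u (.single huv) h
      exact ⟨w, hw, hwu.tail huv⟩

/-- A set of times `S` is covered by a single generalized path as soon as at each time of `S`
some vertex of `U` executes, and every vertex of `U` starting later has an ancestor in `U`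
that executes at that time. -/
lemma exists_genPath_covering [Finite V] {E : V → V → Prop}
    (hacyc : ∀ v : V, ¬ Relation.TransGen E v v) {s e : V → ℝ} (U : Set V) (S : Set ℝ)
    (hS : ∀ t ∈ S, ∃ u ∈ U, Executing s e t u)
    (hanc : ∀ t ∈ S, ∀ v ∈ U, t < s v → ∃ u ∈ U, Executing s e t u ∧ Relation.TransGen E u v) :
    ∃ C : Finset V, IsGenPath E C ∧ ∀ t ∈ S, ∃ u ∈ C, Executing s e t u := by
  classical
  have key : ∀ v ∈ U, ∃ C : Finset V, IsGenPath E C ∧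
      (∀ u ∈ C, u = v ∨ Relation.TransGen E u v) ∧
      ∀ t ∈ S, t < s v + e v → ∃ u ∈ C, Executing s e t u := by
    intro v
    induction v using (wellFounded_transGen hacyc).induction with
    | _ v ih =>
      intro hvU
      rcases Set.eq_empty_or_nonempty {u | u ∈ U ∧ Relation.TransGen E u v} with hemp | hne
      · refine ⟨{v}, ?_, ?_, ?_⟩
        · intro a ha b hb hab
          simp_all
        · intro u hu
          exact .inl (by simpa using hu)
        · intro t ht htv
          rcases le_or_gt (s v) t with h | h
          · exact ⟨v, by simp, h, htv⟩
          · obtain ⟨u, huU, -, huv⟩ := hanc t ht v hvU h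
            exact absurd (show u ∈ {u | u ∈ U ∧ Relation.TransGen E u v} from ⟨huU, huv⟩)
              (by simp [hemp])
      · obtain ⟨w, ⟨hwU, hwv⟩, hmax⟩ :=
          Set.exists_max_image _ (fun u => s u + e u) (Set.toFinite _) hne
        obtain ⟨C, hC, hCw, hcov⟩ := ih w hwv hwU
        have hCv : ∀ u ∈ C, Relation.TransGen E u v := by
          intro u hu
          rcases hCw u hu with rfl | h
          · exact hwv
          · exact h.trans hwv
        refine ⟨insert v C, ?_, ?_, ?_⟩
        · intro a ha b hb hab
          rw [Finset.mem_insert] at ha hb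
          rcases ha with rfl | ha <;> rcases hb with rfl | hb
          · exact absurd rfl hab
          · exact .inr (hCv b hb)
          · exact .inl (hCv a ha)
          · exact hC a ha b hb hab
        · intro u hu
          rw [Finset.mem_insert] at hu
          exact hu.imp id (hCv u)
        · intro t ht htv
          rcases le_or_gt (s v) t with h | h
          · exact ⟨v, by simp, h, htv⟩
          · obtain ⟨u, huU, hut, huv⟩ := hanc t ht v hvU h
            obtain ⟨x, hx, hxt⟩ := hcov t ht (hut.2.trans_le (hmax u ⟨huU, huv⟩))
            exact ⟨x, Finset.mem_insert_of_mem hx, hxt⟩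
  rcases U.eq_empty_or_nonempty with rfl | hne
  · refine ⟨∅, by simp [IsGenPath], fun t ht => ?_⟩
    obtain ⟨u, hu, -⟩ := hS t ht
    exact absurd hu (by simp)
  · obtain ⟨w, hwU, hmax⟩ := Set.exists_max_image U (fun u => s u + e u) (Set.toFinite _) hne
    obtain ⟨C, hC, -, hcov⟩ := key w hwU
    refine ⟨C, hC, fun t ht => ?_⟩
    obtain ⟨u, hu, hut⟩ := hS t ht
    exact hcov t ht (hut.2.trans_le (hmax u hu))

open Classical in
/-- If the total weight of the executing vertices is at least `d` throughout `[0, R)`, then the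
weighted executed work is at least `d * R`. -/
lemma mul_le_sum_of_le_sum_executing [Fintype V] {s e : V → ℝ} (he0 : ∀ v, 0 ≤ e v) (w : V → ℝ)
    (hw : ∀ v, 0 ≤ w v) {d R : ℝ} (hR : 0 ≤ R)
    (h : ∀ t, 0 ≤ t → t < R → d ≤ ∑ v with Executing s e t v, w v) :
    d * R ≤ ∑ v, w v * e v := by
  have hint : ∀ (a b x : ℝ), MeasureTheory.Integrable ((Set.Ico a b).indicator fun _ => x) := by
    intro a b x
    exact (MeasureTheory.integrable_indicator_iff measurableSet_Ico).2
      (MeasureTheory.integrableOn_const (by simp))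
  have hval : ∀ (a b x : ℝ), a ≤ b →
      ∫ t, (Set.Ico a b).indicator (fun _ => x) t = x * (b - a) := by
    intro a b x hab
    rw [MeasureTheory.integral_indicator_const _ measurableSet_Ico]
    simp [MeasureTheory.measureReal_def, hab, mul_comm]
  have hmono : ∫ t, (Set.Ico 0 R).indicator (fun _ => d) t ≤
      ∫ t, ∑ v, (Set.Ico (s v) (s v + e v)).indicator (fun _ => w v) t := by
    refine MeasureTheory.integral_mono (hint _ _ _)
      (MeasureTheory.integrable_finsetSum _ fun v _ => hint _ _ _) fun t => ?_
    by_cases ht : t ∈ Set.Ico 0 R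
    · rw [Set.indicator_of_mem ht]
      refine (h t ht.1 ht.2).trans_eq ?_
      rw [Finset.sum_filter]
      refine Finset.sum_congr rfl fun v _ => ?_
      by_cases hv : Executing s e t v
      · rw [if_pos hv, Set.indicator_of_mem (show t ∈ Set.Ico (s v) (s v + e v) from hv)]
      · rw [if_neg hv, Set.indicator_of_notMem (show t ∉ Set.Ico (s v) (s v + e v) from hv)]
    · rw [Set.indicator_of_notMem ht]
      exact Finset.sum_nonneg fun v _ => Set.indicator_nonneg (fun _ _ => hw v) _
  rw [hval _ _ _ hR, MeasureTheory.integral_finsetSum _ fun v _ => hint _ _ _] at hmono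
  calc d * R = d * (R - 0) := by ring
    _ ≤ _ := hmono
    _ = ∑ v, w v * e v := by
      refine Finset.sum_congr rfl fun v _ => ?_
      rw [hval _ _ _ (by linarith [he0 v])]
      ring

lemma pathLen_le_dagLen [Fintype V] {E : V → V → Prop} (c : V → ℝ) {C : Finset V}
    (hC : IsGenPath E C) : pathLen c C ≤ dagLen E c := by
  refine le_csSup ?_ ⟨C, hC, rfl⟩
  refine (Set.Finite.subset (Set.finite_range (pathLen c)) ?_).bddAbove
  rintro x ⟨P, -, rfl⟩
  exact ⟨P, rfl⟩

theorem single_cardinality_multi_path_bound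
    [Fintype V] [Nonempty V]
    (E : V → V → Prop) (hacyc : ∀ v : V, ¬ Relation.TransGen E v v)
    (c : V → ℝ) (hc : ∀ v, 0 ≤ c v)
    (m : ℕ) (hm : 1 ≤ m)
    (k : ℕ) (hk : k ≤ m - 1)
    -- generalized path list (P_i)_{i=0}^{k}
    (P : ℕ → Finset V)
    (hP : ∀ i ≤ k, IsGenPath E (P i))
    (hPdisj : ∀ i ≤ k, ∀ i' ≤ k, i ≠ i' → Disjoint (P i) (P i'))
    -- an execution sequence of G on m cores
    (s e : V → ℝ)
    (hs : ∀ v, 0 ≤ s v)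
    (he0 : ∀ v, 0 ≤ e v) (hec : ∀ v, e v ≤ c v)
    (hprec : ∀ u v, E u v → s u + e u ≤ s v)
    (hcore : ∀ t : ℝ, Set.ncard {v : V | s v ≤ t ∧ t < s v + e v} ≤ m)
    (hwc : ∀ t : ℝ, 0 ≤ t →
      (∃ v : V, t < s v ∧ ∀ u, E u v → s u + e u ≤ t) →
      Set.ncard {v : V | s v ≤ t ∧ t < s v + e v} = m) :
    -- R ≤ len(G) + (vol(G) − Σ_{i=0}^{k} len(P_i)) / (m − k)
    Finset.univ.sup' Finset.univ_nonempty (fun v => s v + e v) ≤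
      dagLen E c +
        (dagVol c - ∑ i ∈ Finset.range (k + 1), pathLen c (P i)) / ((m : ℝ) - k) := by
  classical
  set R := Finset.univ.sup' Finset.univ_nonempty (fun v => s v + e v) with hRdef
  have hR : 0 ≤ R := by
    obtain ⟨v⟩ := ‹Nonempty V›
    exact (add_nonneg (hs v) (he0 v)).trans
      (Finset.le_sup' (fun v => s v + e v) (Finset.mem_univ v))
  have hcard : ∀ t, Set.ncard {v : V | s v ≤ t ∧ t < s v + e v} =
      (Finset.univ.filter (Executing s e t)).card := by
    intro t
    rw [← Set.ncard_coe_finset]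
    simp [Executing]
  set U : Finset V := (Finset.range (k + 1)).biUnion P with hU
  have hmemU : ∀ v, v ∈ U ↔ ∃ i ≤ k, v ∈ P i := by
    intro v
    simp [hU]
  have hsome : ∀ t, 0 ≤ t → t < R → (Finset.univ.filter (Executing s e t)).card ≠ m →
      ∃ u, Executing s e t u := by
    intro t ht htR hidle
    obtain ⟨v, -, hv⟩ := (Finset.lt_sup'_iff _).1 htR
    rcases le_or_gt (s v) t with h | h
    · exact ⟨v, h, hv⟩
    · obtain ⟨u, hu, -⟩ := exists_executing_ancestor hacyc (hwc t ht) (by rwa [hcard]) v h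
      exact ⟨u, hu⟩
  -- a generalized path executing whenever some core is idle
  obtain ⟨C, hC, hCcov⟩ := exists_genPath_covering hacyc (s := s) (e := e) Set.univ
    {t | 0 ≤ t ∧ t < R ∧ (Finset.univ.filter (Executing s e t)).card ≠ m}
    (fun t ht => by simpa using hsome t ht.1 ht.2.1 ht.2.2)
    (fun t ht v _ htv => by
      simpa using exists_executing_ancestor hacyc (hwc t ht.1) (by rw [hcard]; exact ht.2.2) v htv)
  -- a generalized path executing whenever all `P i` execute, or some core is idle and only
  -- vertices of the `P i` execute
  obtain ⟨D, hD, hDcov⟩ := exists_genPath_covering hacyc (s := s) (e := e) (U : Set V)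
    {t | 0 ≤ t ∧ t < R ∧ ((∀ i ≤ k, ∃ u ∈ P i, Executing s e t u) ∨
      ((Finset.univ.filter (Executing s e t)).card ≠ m ∧ ∀ u, Executing s e t u → u ∈ U))}
    (by
      rintro t ⟨ht, htR, hall | ⟨hidle, hsub⟩⟩
      · obtain ⟨u, hu, hut⟩ := hall 0 (Nat.zero_le _)
        exact ⟨u, (hmemU u).2 ⟨0, Nat.zero_le _, hu⟩, hut⟩
      · obtain ⟨u, hu⟩ := hsome t ht htR hidle
        exact ⟨u, hsub u hu, hu⟩)
    (by
      rintro t ⟨ht, htR, hall | ⟨hidle, hsub⟩⟩ v hv htv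
      · obtain ⟨i, hi, hvi⟩ := (hmemU v).1 hv
        obtain ⟨u, hu, hut⟩ := hall i hi
        refine ⟨u, (hmemU u).2 ⟨i, hi, hu⟩, hut, ?_⟩
        have hut1 := hut.1
        have huv : u ≠ v := by
          rintro rfl
          linarith
        refine (hP i hi u hu v hvi huv).resolve_right fun h => ?_
        linarith [finish_le_start_of_transGen he0 hprec h, he0 v]
      · obtain ⟨u, hu, huv⟩ :=
          exists_executing_ancestor hacyc (hwc t ht) (by rwa [hcard]) v htv
        exact ⟨u, hsub u hu, hu, huv⟩)
  obtain ⟨d, rfl⟩ : ∃ d, m = k + (d + 1) := ⟨m - k - 1, by omega⟩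
  have hpoint : ∀ t, 0 ≤ t → t < R → d + 1 ≤
      ((Finset.univ.filter (Executing s e t)) \ U).card +
      ((Finset.univ.filter (Executing s e t)) ∩ D).card +
      d * ((Finset.univ.filter (Executing s e t)) ∩ C).card := by
    intro t ht htR
    have hDpos : ((∀ i ≤ k, ∃ u ∈ P i, Executing s e t u) ∨
        ((Finset.univ.filter (Executing s e t)).card ≠ k + (d + 1) ∧
          ∀ u, Executing s e t u → u ∈ U)) →
        1 ≤ ((Finset.univ.filter (Executing s e t)) ∩ D).card := by
      intro h
      obtain ⟨u, hu, hut⟩ := hDcov t ⟨ht, htR, h⟩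
      exact Finset.card_pos.2 ⟨u, by simp [hu, hut]⟩
    have hCpos : (Finset.univ.filter (Executing s e t)).card ≠ k + (d + 1) →
        d ≤ d * ((Finset.univ.filter (Executing s e t)) ∩ C).card := by
      intro h
      obtain ⟨u, hu, hut⟩ := hCcov t ⟨ht, htR, h⟩
      exact Nat.le_mul_of_pos_right _ (Finset.card_pos.2 ⟨u, by simp [hu, hut]⟩)
    have hsplit := Finset.card_sdiff_add_card_inter (Finset.univ.filter (Executing s e t)) U
    have hinter : ∀ I : Finset ℕ, I ⊆ Finset.range (k + 1) →
        ((Finset.univ.filter (Executing s e t)) ∩ I.biUnion P).card ≤ I.card := by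
      intro I hI
      rw [Finset.inter_biUnion]
      refine (Finset.card_biUnion_le_card_mul _ _ 1 fun i hi => ?_).trans_eq (mul_one _)
      refine Finset.card_le_one.2 fun a ha b hb => ?_
      simp only [Finset.mem_inter, Finset.mem_filter, Finset.mem_univ, true_and] at ha hb
      exact (hP i (Nat.lt_succ_iff.1 (Finset.mem_range.1 (hI hi)))).eq_of_executing he0 hprec
        ha.2 hb.2 ha.1 hb.1
    by_cases hbusy : (Finset.univ.filter (Executing s e t)).card = k + (d + 1)
    · by_cases hall : ∀ i ≤ k, ∃ u ∈ P i, Executing s e t u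
      · have h1 := hDpos (.inl hall)
        have h2 := hinter _ subset_rfl
        rw [← hU, Finset.card_range] at h2
        omega
      · push Not at hall
        obtain ⟨i, hi, hnone⟩ := hall
        have h2 := hinter _ (Finset.erase_subset i _)
        rw [Finset.card_erase_of_mem (by simpa [Nat.lt_succ_iff] using hi),
          Finset.card_range] at h2
        have h3 : (Finset.univ.filter (Executing s e t)) ∩ U ⊆
            (Finset.univ.filter (Executing s e t)) ∩
              ((Finset.range (k + 1)).erase i).biUnion P := by
          intro u hu
          simp only [Finset.mem_inter, Finset.mem_filter, Finset.mem_univ, true_and, hmemU,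
            Finset.mem_biUnion, Finset.mem_erase, Finset.mem_range] at hu ⊢
          obtain ⟨hut, j, hj, huj⟩ := hu
          refine ⟨hut, j, ⟨?_, by omega⟩, huj⟩
          rintro rfl
          exact hnone u huj hut
        have h4 := Finset.card_le_card h3
        omega
    · have h1 := hCpos hbusy
      by_cases hsub : ∀ u, Executing s e t u → u ∈ U
      · have h2 := hDpos (.inr ⟨hbusy, hsub⟩)
        omega
      · push Not at hsub
        obtain ⟨u, hut, hu⟩ := hsub
        have h2 : 0 < ((Finset.univ.filter (Executing s e t)) \ U).card :=
          Finset.card_pos.2 ⟨u, by simp [hu, hut]⟩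
        omega
  have hwork := mul_le_sum_of_le_sum_executing he0 (s := s) (d := (d : ℝ) + 1) (R := R)
    (fun v => (if v ∈ U then 0 else 1) + (if v ∈ D then 1 else 0) + d * (if v ∈ C then 1 else 0))
    (fun v => by positivity) hR (fun t ht htR => by
      have h := hpoint t ht htR
      have hcast : ((d : ℝ) + 1) ≤
          (((Finset.univ.filter (Executing s e t)) \ U).card : ℝ) +
          ((Finset.univ.filter (Executing s e t)) ∩ D).card +
          d * ((Finset.univ.filter (Executing s e t)) ∩ C).card := by exact_mod_cast h
      refine hcast.trans_eq ?_
      rw [Finset.sum_add_distrib, Finset.sum_add_distrib, ← Finset.mul_sum, Finset.sum_boole,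
        Finset.sum_boole, Finset.filter_mem_eq_inter, Finset.filter_mem_eq_inter,
        Finset.sdiff_eq_filter, ← Finset.sum_boole]
      simp only [ite_not])
  have hvol : dagVol c - ∑ i ∈ Finset.range (k + 1), pathLen c (P i) = ∑ v ∈ Uᶜ, c v := by
    have h1 : ∑ i ∈ Finset.range (k + 1), pathLen c (P i) = ∑ v ∈ U, c v := by
      rw [hU, Finset.sum_biUnion]
      · rfl
      · intro i hi j hj hij
        simp only [Finset.coe_range, Set.mem_Iio, Nat.lt_succ_iff] at hi hj
        exact hPdisj i hi j hj hij
    rw [h1, dagVol, ← Finset.sum_add_sum_compl U c]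
    ring
  have hsum : ∑ v, ((if v ∈ U then 0 else 1) + (if v ∈ D then 1 else 0) +
      d * (if v ∈ C then 1 else 0)) * e v =
      ∑ v ∈ Uᶜ, e v + ∑ v ∈ D, e v + d * ∑ v ∈ C, e v := by
    have hUc : ∑ v ∈ Uᶜ, e v = ∑ v, if v ∈ U then 0 else e v := by
      rw [← Finset.sum_add_sum_compl U, Finset.sum_eq_zero fun v hv => if_pos hv, zero_add]
      exact Finset.sum_congr rfl fun v hv => (if_neg (Finset.mem_compl.1 hv)).symm
    simp [add_mul, Finset.sum_add_distrib, ← Finset.mul_sum, hUc, ite_mul]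
  have hDlen : ∑ v ∈ D, e v ≤ dagLen E c :=
    (Finset.sum_le_sum fun v _ => hec v).trans (pathLen_le_dagLen c hD)
  have hClen : ∑ v ∈ C, e v ≤ dagLen E c :=
    (Finset.sum_le_sum fun v _ => hec v).trans (pathLen_le_dagLen c hC)
  have hUlen : ∑ v ∈ Uᶜ, e v ≤ ∑ v ∈ Uᶜ, c v := Finset.sum_le_sum fun v _ => hec v
  rw [hsum] at hwork
  have hdC := mul_le_mul_of_nonneg_left hClen (Nat.cast_nonneg (α := ℝ) d)
  have hden : ((k + (d + 1) : ℕ) : ℝ) - k = d + 1 := by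
    push_cast
    ring
  have hdpos : (0 : ℝ) < d + 1 := by positivity
  rw [hvol, hden, ← sub_le_iff_le_add', le_div_iff₀ hdpos]
  linarith
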